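/- Lemma B.1 (closeness of the data-dependent truncation to a fixed truncation, no sample splitting). There exist universal constants c, C > 0 such that the following holds. Assume Assumption 1 and let the a_ki and y_ki be as in the context, with C̃ := 9κ²μ². Fix ε₁ ∈ (0,1). Define the random threshold α := C̃·(1/(mq))·Σ_{k,i}y_ki², the deterministic threshold α₊ := C̃(1 + ε₁)·‖X*‖_F²/q, and the n×q random matrices X̂₀ := (1/m)·Σ_{k,i} a_ki·y_ki·1{y_ki² ≤ α}·e_kᵀ and X₊ := (1/m)·Σ_{k,i} a_ki·y_ki·1{y_ki² ≤ α₊}·e_kᵀ. Then the probability of the joint event that (1 − ε₁)‖X*‖_F²/q ≤ (1/(mq))·Σ_{k,i}y_ki² ≤ (1 + ε₁)‖X*‖_F²/q and ‖X̂₀ − X₊‖ > C·ε₁·μκ·‖X*‖_F is at most exp(C(n+q) − c·ε₁²·mq/(μ²κ²)). -/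

import Mathlib

open MeasureTheory ProbabilityTheory Matrix
open scoped ENNReal

noncomputable section

/-- Euclidean norm of a finitely-indexed real vector. -/
def vnorm {ι : Type*} [Fintype ι] (v : ι → ℝ) : ℝ := Real.sqrt (∑ i, v i ^ 2)

/-- Frobenius norm of a real matrix. -/
def frob {ι ι' : Type*} [Fintype ι] [Fintype ι'] (M : Matrix ι ι' ℝ) : ℝ :=
  Real.sqrt (∑ i, ∑ j, M i j ^ 2)

/-- Spectral (ℓ2 operator) norm of a real matrix. -/
def spec {ι ι' : Type*} [Fintype ι] [Fintype ι'] (M : Matrix ι ι' ℝ) : ℝ :=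
  sSup {c | ∃ z, vnorm z = 1 ∧ c = vnorm (M.mulVec z)}

/-- Smallest singular value of an r×q matrix with r ≤ q (or of a square matrix):
the minimum of ‖Bᵀw‖ over unit vectors w. -/
def sigMin {ι ι' : Type*} [Fintype ι] [Fintype ι'] (B : Matrix ι ι' ℝ) : ℝ :=
  sInf {c | ∃ w, vnorm w = 1 ∧ c = vnorm (Bᵀ.mulVec w)}

/-- The k-th column of a matrix. -/
def matCol {ι ι' : Type*} (B : Matrix ι ι' ℝ) (k : ι') : ι → ℝ := fun i => B i k

/-- Subspace distance SD(U₁,U₂) := ‖(I − U₁U₁ᵀ)U₂‖_F. -/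
def SD {n r : ℕ} (U₁ U₂ : Matrix (Fin n) (Fin r) ℝ) : ℝ :=
  frob ((1 - U₁ * U₁ᵀ) * U₂)

/-- The standard Gaussian measure on ℝ. -/
def stdGaussian : Measure ℝ := gaussianReal 0 1

instance : IsProbabilityMeasure stdGaussian :=
  inferInstanceAs (IsProbabilityMeasure (gaussianReal 0 1))

/-- A standard Gaussian random vector in ℝⁿ (i.i.d. N(0,1) coordinates). -/
def gaussianVec (n : ℕ) : Measure (Fin n → ℝ) := Measure.pi fun _ => stdGaussian

instance (n : ℕ) : IsProbabilityMeasure (gaussianVec n) := by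
  unfold gaussianVec; infer_instance

/-- i.i.d. standard Gaussian random vectors a_{k i} ∈ ℝⁿ, k ∈ [q], i ∈ [m]. -/
def gaussianMatrices (q m n : ℕ) : Measure (Fin q → Fin m → Fin n → ℝ) :=
  Measure.pi fun _ => Measure.pi fun _ => gaussianVec n

instance (q m n : ℕ) : IsProbabilityMeasure (gaussianMatrices q m n) := by
  unfold gaussianMatrices; infer_instance

/-- Truncated spectral-initialization matrix X̂₀ = (1/m) Σ_{k,i} a_ki y_ki 1{y_ki² ≤ α} e_kᵀ. -/
def initMat {n q m : ℕ} (xstar : Fin q → Fin n → ℝ) (α : ℝ)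
    (ω : Fin q → Fin m → Fin n → ℝ) : Matrix (Fin n) (Fin q) ℝ :=
  Matrix.of fun j k => (1 / (m : ℝ)) * ∑ i, ω k i j * (ω k i ⬝ᵥ xstar k) *
    (if (ω k i ⬝ᵥ xstar k) ^ 2 ≤ α then 1 else 0)

/-- Data-dependent truncation threshold α := C̃ Σ_{k,i} y_ki² / (mq). -/
def initAlpha {n q m : ℕ} (xstar : Fin q → Fin n → ℝ) (Ctil : ℝ)
    (ω : Fin q → Fin m → Fin n → ℝ) : ℝ :=
  Ctil * ((∑ k, ∑ i, (ω k i ⬝ᵥ xstar k) ^ 2) / ((m : ℝ) * q))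

/-- β(α) := E[ζ² 1{‖x‖² ζ² ≤ α}] for ζ standard Gaussian. -/
def betaK (normx α : ℝ) : ℝ :=
  ∫ z, z ^ 2 * (if normx ^ 2 * z ^ 2 ≤ α then 1 else 0) ∂stdGaussian

/-- The least-squares estimate b̂ := (UᵀAᵀAU)⁻¹ Uᵀ Aᵀ A x. -/
def lsEst {n r m : ℕ} (U : Matrix (Fin n) (Fin r) ℝ) (A : Matrix (Fin m) (Fin n) ℝ)
    (x : Fin n → ℝ) : Fin r → ℝ :=
  ((Uᵀ * Aᵀ * A * U)⁻¹ * Uᵀ * Aᵀ * A).mulVec x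

/-- Gradient w.r.t. U of the squared loss: Σ_k Aᵀ(AUb̂_k − Ax*_k)b̂_kᵀ. -/
def gradU {n r q m : ℕ} (U : Matrix (Fin n) (Fin r) ℝ)
    (A : Fin q → Matrix (Fin m) (Fin n) ℝ) (xstar : Fin q → Fin n → ℝ)
    (bhat : Fin q → Fin r → ℝ) : Matrix (Fin n) (Fin r) ℝ :=
  ∑ k, (A k)ᵀ * vecMulVec ((A k).mulVec (U.mulVec (bhat k) - xstar k)) (bhat k)

/-- `U` has orthonormal columns whose span is the span of eigenvectors of `S`
corresponding to its `r` largest eigenvalues: `S` maps the column span of `U` into itself,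
and wᵀSw ≥ zᵀSz for unit w in the span and unit z orthogonal to it. -/
def IsTopREigenBasis {n r : ℕ} (S : Matrix (Fin n) (Fin n) ℝ)
    (U : Matrix (Fin n) (Fin r) ℝ) : Prop :=
  Uᵀ * U = 1 ∧ (∃ M : Matrix (Fin r) (Fin r) ℝ, S * U = U * M) ∧
  ∀ w z : Fin n → ℝ, (∃ cvec : Fin r → ℝ, w = U.mulVec cvec) → Uᵀ.mulVec z = 0 →
    vnorm w = 1 → vnorm z = 1 → z ⬝ᵥ S.mulVec z ≤ w ⬝ᵥ S.mulVec w

/-- Sample sizes for the 2T+1 sample splits: batch τ ∈ {0,…,T} has m τ rows,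
batch τ = T + t (t ∈ {1,…,T}) has m t rows. -/
def msize (m : ℕ → ℕ) (T τ : ℕ) : ℕ := if τ ≤ T then m τ else m (τ - T)

/-- The joint distribution of all 2T+1 independent sample batches of i.i.d. standard
Gaussian measurement vectors. -/
def splitGauss (m : ℕ → ℕ) (T q n : ℕ) :
    Measure (∀ τ : Fin (2 * T + 1), Fin q → Fin (msize m T τ.1) → Fin n → ℝ) :=
  Measure.pi fun τ => gaussianMatrices q (msize m T τ.1) n

instance (m : ℕ → ℕ) (T q n : ℕ) : IsProbabilityMeasure (splitGauss m T q n) := by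
  unfold splitGauss; infer_instance

end

theorem vnorm_nonneg {ι : Type*} [Fintype ι] (v : ι → ℝ) : 0 ≤ vnorm v := Real.sqrt_nonneg _

theorem vnorm_sq {ι : Type*} [Fintype ι] (v : ι → ℝ) : vnorm v ^ 2 = v ⬝ᵥ v := by
  rw [vnorm, Real.sq_sqrt (Finset.sum_nonneg fun i _ => sq_nonneg _)]
  simp [dotProduct, sq]

theorem vnorm_smul {ι : Type*} [Fintype ι] (c : ℝ) (v : ι → ℝ) :
    vnorm (c • v) = |c| * vnorm v := by
  refine (pow_left_inj₀ (vnorm_nonneg _) (by have := vnorm_nonneg v; positivity)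
    two_ne_zero).1 ?_
  rw [mul_pow, vnorm_sq, vnorm_sq, sq_abs, smul_dotProduct, dotProduct_smul, smul_eq_mul,
    smul_eq_mul]
  ring

theorem vnorm_eq_zero {ι : Type*} [Fintype ι] {v : ι → ℝ} : vnorm v = 0 ↔ v = 0 := by
  rw [← pow_eq_zero_iff two_ne_zero, vnorm_sq, dotProduct_self_eq_zero]

theorem vnorm_inv_smul_self {ι : Type*} [Fintype ι] {v : ι → ℝ} (hv : v ≠ 0) :
    vnorm ((vnorm v)⁻¹ • v) = 1 := by
  have h : vnorm v ≠ 0 := mt vnorm_eq_zero.1 hv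
  rw [vnorm_smul, abs_of_nonneg (inv_nonneg.2 (vnorm_nonneg v)), inv_mul_cancel₀ h]

theorem abs_dotProduct_le {ι : Type*} [Fintype ι] (v w : ι → ℝ) :
    |v ⬝ᵥ w| ≤ vnorm v * vnorm w := by
  refine abs_le_of_sq_le_sq ?_ (mul_nonneg (vnorm_nonneg v) (vnorm_nonneg w))
  rw [mul_pow, vnorm_sq, vnorm_sq]
  simpa [dotProduct, sq] using Finset.sum_mul_sq_le_sq_mul_sq Finset.univ v w

theorem vnorm_le_of_abs_le {ι : Type*} [Fintype ι] {v w : ι → ℝ} (h : ∀ i, |v i| ≤ |w i|) :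
    vnorm v ≤ vnorm w :=
  Real.sqrt_le_sqrt (Finset.sum_le_sum fun i _ => sq_le_sq.2 (h i))

theorem sum_abs_le_sqrt_mul_vnorm {d : ℕ} (v : Fin d → ℝ) :
    ∑ i, |v i| ≤ Real.sqrt d * vnorm v := by
  have h := abs_dotProduct_le (fun _ : Fin d => (1 : ℝ)) (fun i => |v i|)
  have h1 : vnorm (fun _ : Fin d => (1 : ℝ)) = Real.sqrt d := by simp [vnorm]
  have h2 : vnorm (fun i => |v i|) = vnorm v := by simp [vnorm]
  rw [h1, h2] at h
  refine le_trans (le_trans (le_of_eq ?_) (le_abs_self _)) h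
  simp [dotProduct]

theorem vnorm_mulVec_le_frob {ι ι' : Type*} [Fintype ι] [Fintype ι'] (M : Matrix ι ι' ℝ)
    (z : ι' → ℝ) : vnorm (M.mulVec z) ≤ frob M * vnorm z := by
  rw [vnorm, vnorm, frob, ← Real.sqrt_mul (by positivity), Finset.sum_mul]
  refine Real.sqrt_le_sqrt (Finset.sum_le_sum fun i _ => ?_)
  exact Finset.sum_mul_sq_le_sq_mul_sq Finset.univ (M i) z

theorem vnorm_mulVec_le_spec {ι ι' : Type*} [Fintype ι] [Fintype ι'] (M : Matrix ι ι' ℝ)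
    (z : ι' → ℝ) : vnorm (M.mulVec z) ≤ spec M * vnorm z := by
  by_cases hz : z = 0
  · subst hz
    simp [vnorm]
  have h0 : 0 < vnorm z := (vnorm_nonneg z).lt_of_ne' (mt vnorm_eq_zero.1 hz)
  have h1 : vnorm (M.mulVec ((vnorm z)⁻¹ • z)) ≤ spec M := by
    refine le_csSup ⟨frob M, ?_⟩ ⟨_, vnorm_inv_smul_self hz, rfl⟩
    rintro c ⟨y, hy, rfl⟩
    simpa [hy] using vnorm_mulVec_le_frob M y
  rw [mulVec_smul, vnorm_smul, abs_of_pos (inv_pos.2 h0)] at h1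
  rwa [inv_mul_le_iff₀ h0, mul_comm] at h1

theorem spec_nonneg {ι ι' : Type*} [Fintype ι] [Fintype ι'] (M : Matrix ι ι' ℝ) :
    0 ≤ spec M := by
  refine Real.sSup_nonneg ?_
  rintro c ⟨z, -, rfl⟩
  exact vnorm_nonneg _

theorem spec_zero {ι ι' : Type*} [Fintype ι] [Fintype ι'] : spec (0 : Matrix ι ι' ℝ) = 0 := by
  refine le_antisymm (Real.sSup_nonpos ?_) (spec_nonneg _)
  rintro c ⟨z, -, rfl⟩
  simp [vnorm]

/-- A bilinear form bounded by `t` on the product of two `1/4`-nets of the unit spheres has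
spectral norm at most `2 * t`. -/
theorem spec_le_of_net {n q : ℕ} (M : Matrix (Fin n) (Fin q) ℝ)
    {N₁ : Finset (Fin n → ℝ)} {N₂ : Finset (Fin q → ℝ)} {t : ℝ} (ht : 0 ≤ t)
    (hN₁ : ∀ v ∈ N₁, vnorm v ≤ 1)
    (hcover₁ : ∀ w, vnorm w = 1 → ∃ v ∈ N₁, vnorm (w - v) ≤ 1 / 4)
    (hcover₂ : ∀ w, vnorm w = 1 → ∃ v ∈ N₂, vnorm (w - v) ≤ 1 / 4)
    (hM : ∀ v ∈ N₁, ∀ z ∈ N₂, |v ⬝ᵥ M.mulVec z| ≤ t) : spec M ≤ 2 * t := by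
  have hS := spec_nonneg M
  suffices h : spec M ≤ t + spec M / 2 by linarith
  refine Real.sSup_le ?_ (by positivity)
  rintro c ⟨z, hz, rfl⟩
  by_cases h0 : M.mulVec z = 0
  · simp only [h0, vnorm_eq_zero.2]
    positivity
  set y := M.mulVec z with hy
  set w := (vnorm y)⁻¹ • y with hw
  have hwn : vnorm w = 1 := vnorm_inv_smul_self h0
  have hpos : vnorm y ≠ 0 := mt vnorm_eq_zero.1 h0
  have hwy : w ⬝ᵥ y = vnorm y := by
    rw [hw, smul_dotProduct, ← vnorm_sq, smul_eq_mul]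
    field_simp
  obtain ⟨v, hv, hvw⟩ := hcover₁ w hwn
  obtain ⟨u, hu, huz⟩ := hcover₂ z hz
  have e : w ⬝ᵥ y = v ⬝ᵥ M.mulVec u + v ⬝ᵥ M.mulVec (z - u) + (w - v) ⬝ᵥ y := by
    rw [mulVec_sub, dotProduct_sub, sub_dotProduct, ← hy]
    ring
  have b1 := (le_abs_self _).trans (hM v hv u hu)
  have b2 : v ⬝ᵥ M.mulVec (z - u) ≤ spec M / 4 := by
    calc v ⬝ᵥ M.mulVec (z - u) ≤ vnorm v * vnorm (M.mulVec (z - u)) :=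
          (le_abs_self _).trans (abs_dotProduct_le _ _)
      _ ≤ 1 * (spec M * (1 / 4)) := by
          refine mul_le_mul (hN₁ v hv) ?_ (vnorm_nonneg _) zero_le_one
          exact (vnorm_mulVec_le_spec M _).trans (mul_le_mul_of_nonneg_left huz hS)
      _ = spec M / 4 := by ring
  have b3 : (w - v) ⬝ᵥ y ≤ spec M / 4 := by
    calc (w - v) ⬝ᵥ y ≤ vnorm (w - v) * vnorm y :=
          (le_abs_self _).trans (abs_dotProduct_le _ _)
      _ ≤ 1 / 4 * spec M := by
          refine mul_le_mul hvw ?_ (vnorm_nonneg _) (by norm_num)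
          simpa [hz] using vnorm_mulVec_le_spec M z
      _ = spec M / 4 := by ring
  linarith

theorem exists_int_abs_le (x : ℝ) : ∃ j : ℤ, |(j : ℝ)| ≤ |x| ∧ |x - j| ≤ 1 := by
  rcases le_total 0 x with hx | hx
  · refine ⟨⌊x⌋, ?_, ?_⟩
    · rw [abs_of_nonneg hx, abs_of_nonneg (by exact_mod_cast Int.floor_nonneg.2 hx)]
      exact Int.floor_le x
    · rw [abs_le]
      constructor <;> linarith [Int.floor_le x, Int.lt_floor_add_one x]
  · refine ⟨⌈x⌉, ?_, ?_⟩
    · have : (⌈x⌉ : ℝ) ≤ 0 := by exact_mod_cast Int.ceil_le.2 (by simpa using hx)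
      rw [abs_of_nonpos hx, abs_of_nonpos this]
      linarith [Int.le_ceil x]
    · rw [abs_le]
      constructor <;> linarith [Int.le_ceil x, Int.ceil_lt_add_one x]

theorem sum_half_pow_natAbs_le (M : ℕ) :
    ∑ j ∈ Finset.Icc (-(M : ℤ)) M, (1 / 2 : ℝ) ^ j.natAbs ≤ 4 := by
  have hgeom : ∑ j ∈ Finset.range (M + 1), (1 / 2 : ℝ) ^ j ≤ 2 := sum_geometric_two_le _
  have hsub : Finset.Icc (-(M : ℤ)) M ⊆ (Finset.range (M + 1)).image (fun j : ℕ => (j : ℤ)) ∪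
      (Finset.range (M + 1)).image (fun j : ℕ => -(j : ℤ)) := by
    intro j hj
    rw [Finset.mem_Icc] at hj
    simp only [Finset.mem_union, Finset.mem_image, Finset.mem_range]
    rcases le_total 0 j with h | h
    · exact Or.inl ⟨j.toNat, by omega, by omega⟩
    · exact Or.inr ⟨(-j).toNat, by omega, by omega⟩
  refine (Finset.sum_le_sum_of_subset_of_nonneg hsub fun _ _ _ => by positivity).trans ?_
  have h1 := Finset.sum_union_inter (s₁ := (Finset.range (M + 1)).image (fun j : ℕ => (j : ℤ)))
    (s₂ := (Finset.range (M + 1)).image (fun j : ℕ => -(j : ℤ)))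
    (f := fun j : ℤ => (1 / 2 : ℝ) ^ j.natAbs)
  rw [Finset.sum_image (by simp), Finset.sum_image (by simp)] at h1
  have h0 : 0 ≤ ∑ j ∈ (Finset.range (M + 1)).image (fun j : ℕ => (j : ℤ)) ∩
      (Finset.range (M + 1)).image (fun j : ℕ => -(j : ℤ)), (1 / 2 : ℝ) ^ j.natAbs :=
    Finset.sum_nonneg fun _ _ => by positivity
  simp only [Int.natAbs_neg, Int.natAbs_natCast] at h1
  linarith

/-- The number of integer points of the `ℓ¹`-ball of radius `4 * d` in dimension `d` is at most
exponential in `d`. -/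
theorem card_filter_sum_natAbs_le {d : ℕ} {S : Finset ℤ}
    (hS : ∑ j ∈ S, (1 / 2 : ℝ) ^ j.natAbs ≤ 4) :
    ((Fintype.piFinset fun _ : Fin d => S).filter
      fun k => ∑ i, (k i).natAbs ≤ 4 * d).card ≤ 64 ^ d := by
  have h : (((Fintype.piFinset fun _ : Fin d => S).filter
      fun k => ∑ i, (k i).natAbs ≤ 4 * d).card : ℝ) ≤ 64 ^ d := by
    calc _ = ∑ k ∈ (Fintype.piFinset fun _ : Fin d => S).filter
          (fun k => ∑ i, (k i).natAbs ≤ 4 * d), (1 : ℝ) := by simp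
      _ ≤ ∑ k ∈ (Fintype.piFinset fun _ : Fin d => S).filter
          (fun k => ∑ i, (k i).natAbs ≤ 4 * d), ∏ i, 16 * (1 / 2 : ℝ) ^ (k i).natAbs := by
          refine Finset.sum_le_sum fun k hk => ?_
          have hk' := (Finset.mem_filter.1 hk).2
          rw [Finset.prod_mul_distrib, Finset.prod_pow_eq_pow_sum]
          have h1 : (1 / 2 : ℝ) ^ (4 * d) ≤ (1 / 2 : ℝ) ^ ∑ i, (k i).natAbs :=
            pow_le_pow_of_le_one (by norm_num) (by norm_num) hk'
          calc (1 : ℝ) = 16 ^ d * (1 / 2 : ℝ) ^ (4 * d) := by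
                rw [pow_mul, ← mul_pow]; norm_num
            _ ≤ _ := by simpa using h1
      _ ≤ ∑ k ∈ Fintype.piFinset fun _ : Fin d => S,
            ∏ i, 16 * (1 / 2 : ℝ) ^ (k i).natAbs :=
          Finset.sum_le_sum_of_subset_of_nonneg (Finset.filter_subset _ _)
            fun _ _ _ => Finset.prod_nonneg fun _ _ => by positivity
      _ = ∏ _i : Fin d, ∑ j ∈ S, 16 * (1 / 2 : ℝ) ^ j.natAbs :=
          by rw [Finset.prod_univ_sum]
      _ ≤ ∏ _i : Fin d, (64 : ℝ) := by
          refine Finset.prod_le_prod (fun _ _ => Finset.sum_nonneg fun _ _ => by positivity)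
            fun _ _ => ?_
          rw [← Finset.mul_sum]
          linarith
      _ = 64 ^ d := by simp
  exact_mod_cast h

theorem exists_net (d : ℕ) : ∃ N : Finset (Fin d → ℝ), N.card ≤ 64 ^ d ∧
    (∀ v ∈ N, vnorm v ≤ 1) ∧ ∀ w, vnorm w = 1 → ∃ v ∈ N, vnorm (w - v) ≤ 1 / 4 := by
  classical
  set s : ℝ := 4 * Real.sqrt d with hs
  refine ⟨(((Fintype.piFinset fun _ : Fin d => Finset.Icc (-((4 * d : ℕ) : ℤ)) (4 * d : ℕ)).filter
      fun k => ∑ i, (k i).natAbs ≤ 4 * d).image fun k i => (k i : ℝ) / s).filter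
      fun v => vnorm v ≤ 1, ?_, fun v hv => (Finset.mem_filter.1 hv).2, fun w hw => ?_⟩
  · exact (Finset.card_filter_le _ _).trans
      (Finset.card_image_le.trans (card_filter_sum_natAbs_le (sum_half_pow_natAbs_le (4 * d))))
  have hd : 0 < d := by
    rcases Nat.eq_zero_or_pos d with rfl | h
    · simp [vnorm] at hw
    · exact h
  have hsq : Real.sqrt d * Real.sqrt d = d := Real.mul_self_sqrt (Nat.cast_nonneg d)
  have hd' : 0 < Real.sqrt d := Real.sqrt_pos.2 (by exact_mod_cast hd)
  have hs0 : 0 < s := by positivity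
  choose k hk1 hk2 using fun i => exists_int_abs_le (w i * s)
  have hsum : ∑ i, (k i).natAbs ≤ 4 * d := by
    have : ∑ i, |(k i : ℝ)| ≤ 4 * d := by
      calc ∑ i, |(k i : ℝ)| ≤ ∑ i, |w i| * s := Finset.sum_le_sum fun i _ => by
            simpa [abs_mul, abs_of_pos hs0] using hk1 i
        _ = (∑ i, |w i|) * s := (Finset.sum_mul _ _ _).symm
        _ ≤ (Real.sqrt d * 1) * s := by
            gcongr
            simpa [hw] using sum_abs_le_sqrt_mul_vnorm w
        _ = 4 * d := by rw [hs]; linear_combination 4 * hsq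
    have h2 : ((∑ i, (k i).natAbs : ℕ) : ℝ) = ∑ i, |(k i : ℝ)| := by
      push_cast
      simp [Nat.cast_natAbs]
    rw [← h2] at this
    exact_mod_cast this
  have hmem : ∀ i, k i ∈ Finset.Icc (-((4 * d : ℕ) : ℤ)) (4 * d : ℕ) := by
    intro i
    have := Finset.single_le_sum (f := fun i => (k i).natAbs) (fun _ _ => Nat.zero_le _)
      (Finset.mem_univ i)
    rw [Finset.mem_Icc]
    omega
  refine ⟨fun i => (k i : ℝ) / s, ?_, ?_⟩
  · refine Finset.mem_filter.2 ⟨Finset.mem_image.2 ⟨k, Finset.mem_filter.2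
      ⟨Fintype.mem_piFinset.2 hmem, hsum⟩, rfl⟩, ?_⟩
    rw [← hw]
    refine vnorm_le_of_abs_le fun i => ?_
    rw [abs_div, abs_of_pos hs0, div_le_iff₀ hs0]
    simpa [abs_mul, abs_of_pos hs0] using hk1 i
  · calc vnorm (w - fun i => (k i : ℝ) / s) ≤ vnorm (fun _ : Fin d => 1 / s) := by
          refine vnorm_le_of_abs_le fun i => ?_
          have : (w - fun i => (k i : ℝ) / s) i = (w i * s - k i) / s := by
            simp only [Pi.sub_apply]
            field_simp
          rw [this, abs_div, abs_div, abs_one]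
          gcongr
          exact hk2 i
      _ = 1 / 4 := by
          rw [vnorm, Finset.sum_const, Finset.card_univ, Fintype.card_fin, nsmul_eq_mul, hs]
          rw [Real.sqrt_eq_iff_mul_self_eq (by positivity) (by norm_num)]
          field_simp
          rw [sq, hsq]
          try norm_num

theorem map_eval_gaussianVec {n : ℕ} (i : Fin n) :
    (gaussianVec n).map (fun a => a i) = gaussianReal 0 1 :=
  (measurePreserving_eval (fun _ : Fin n => gaussianReal 0 1) i).map_eq

theorem hasGaussianLaw_gaussianVec (n : ℕ) : HasGaussianLaw id (gaussianVec n) :=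
  iIndepFun.hasGaussianLaw (X := fun (i : Fin n) (a : Fin n → ℝ) => a i)
    (fun i => HasLaw.hasGaussianLaw (μ := gaussianReal 0 1)
      ⟨(measurable_pi_apply i).aemeasurable, map_eval_gaussianVec i⟩)
    (iIndepFun_pi (X := fun _ => id) fun _ => aemeasurable_id)

theorem measurable_dotProduct_const {n : ℕ} (w : Fin n → ℝ) :
    Measurable fun a : Fin n → ℝ => a ⬝ᵥ w := by
  unfold dotProduct
  fun_prop

/-- The linear form `a ↦ a ⬝ᵥ w` as a continuous linear map. -/
def dotProductCLM {n : ℕ} (w : Fin n → ℝ) : (Fin n → ℝ) →L[ℝ] ℝ :=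
  ∑ i, w i • ContinuousLinearMap.proj (R := ℝ) (φ := fun _ : Fin n => ℝ) i

theorem dotProductCLM_apply {n : ℕ} (w a : Fin n → ℝ) : dotProductCLM w a = a ⬝ᵥ w := by
  simp [dotProductCLM, dotProduct, mul_comm]

theorem hasGaussianLaw_dotProduct_prod {n : ℕ} (w x : Fin n → ℝ) :
    HasGaussianLaw (fun a : Fin n → ℝ => (a ⬝ᵥ w, a ⬝ᵥ x)) (gaussianVec n) := by
  have h := (hasGaussianLaw_gaussianVec n).map_fun ((dotProductCLM w).prod (dotProductCLM x))
  simpa only [id, ContinuousLinearMap.prod_apply, dotProductCLM_apply] using h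

theorem memLp_eval_gaussianVec {n : ℕ} (i : Fin n) :
    MemLp (fun a : Fin n → ℝ => a i) 2 (gaussianVec n) :=
  ((hasGaussianLaw_gaussianVec n).eval i).memLp_two

theorem covariance_eval_gaussianVec {n : ℕ} (i j : Fin n) :
    cov[fun a => a i, fun a => a j; gaussianVec n] = if i = j then 1 else 0 := by
  split_ifs with h
  · subst h
    have h1 : Var[fun x => x; (gaussianVec n).map fun a => a i] = 1 := by
      rw [map_eval_gaussianVec]
      simp
    rw [covariance_self (measurable_pi_apply i).aemeasurable]
    rwa [variance_map aemeasurable_id' (measurable_pi_apply i).aemeasurable] at h1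
  · exact IndepFun.covariance_eq_zero
      ((iIndepFun_pi (μ := fun _ : Fin n => stdGaussian) (X := fun _ => id)
        fun _ => aemeasurable_id).indepFun h)
      (memLp_eval_gaussianVec i) (memLp_eval_gaussianVec j)

theorem covariance_dotProduct {n : ℕ} (w x : Fin n → ℝ) :
    cov[fun a => a ⬝ᵥ w, fun a => a ⬝ᵥ x; gaussianVec n] = w ⬝ᵥ x := by
  unfold dotProduct
  rw [covariance_fun_sum_fun_sum (fun i => (memLp_eval_gaussianVec i).mul_const _)
    (fun i => (memLp_eval_gaussianVec i).mul_const _)]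
  simp_rw [covariance_mul_const_left, covariance_mul_const_right, covariance_eval_gaussianVec]
  simp [mul_comm]

theorem indepFun_dotProduct {n : ℕ} {w x : Fin n → ℝ} (h : w ⬝ᵥ x = 0) :
    IndepFun (fun a => a ⬝ᵥ w) (fun a => a ⬝ᵥ x) (gaussianVec n) :=
  (hasGaussianLaw_dotProduct_prod w x).indepFun_of_covariance_eq_zero
    ((covariance_dotProduct w x).trans h)

theorem map_dotProduct_gaussianVec {n : ℕ} (w : Fin n → ℝ) :
    (gaussianVec n).map (fun a => a ⬝ᵥ w) = gaussianReal 0 (vnorm w ^ 2).toNNReal := by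
  have h := (hasGaussianLaw_dotProduct_prod w w).fst
  have hmean : ∫ a, a ⬝ᵥ w ∂gaussianVec n = 0 := by
    have hi : ∀ i, ∫ a, a i ∂gaussianVec n = 0 := fun i => by
      have h1 : ∫ x, x ∂(gaussianVec n).map (fun a => a i) = 0 := by
        rw [map_eval_gaussianVec]
        simp
      rwa [integral_map (measurable_pi_apply i).aemeasurable (by fun_prop)] at h1
    unfold dotProduct
    rw [integral_finsetSum _ fun i _ =>
      ((memLp_eval_gaussianVec i).integrable one_le_two).mul_const _]
    simp [integral_mul_const, hi]
  rw [h.map_eq_gaussianReal, hmean, ← covariance_self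
    (measurable_dotProduct_const w).aemeasurable, covariance_dotProduct, vnorm_sq]

theorem lintegral_exp_mul_abs_gaussianReal_le {v : NNReal} (hv : v ≤ 1) (τ : ℝ) :
    ∫⁻ x, ENNReal.ofReal (Real.exp (τ * |x|)) ∂gaussianReal 0 v ≤
      ENNReal.ofReal (2 * Real.exp (τ ^ 2 / 2)) := by
  have hi := fun t : ℝ => integrable_exp_mul_gaussianReal (μ := 0) (v := v) t
  have hm : ∀ t : ℝ, ∫ x, Real.exp (t * x) ∂gaussianReal 0 v ≤ Real.exp (t ^ 2 / 2) := fun t => by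
    have h : mgf id (gaussianReal 0 v) t = _ := congrFun mgf_id_gaussianReal t
    have h' : ∫ x, Real.exp (t * x) ∂gaussianReal 0 v = Real.exp (0 * t + v * t ^ 2 / 2) := h
    rw [h', Real.exp_le_exp, zero_mul, zero_add]
    have : (v : ℝ) ≤ 1 := by exact_mod_cast hv
    nlinarith [sq_nonneg t]
  calc ∫⁻ x, ENNReal.ofReal (Real.exp (τ * |x|)) ∂gaussianReal 0 v
      ≤ ∫⁻ x, ENNReal.ofReal (Real.exp (τ * x) + Real.exp (-τ * x)) ∂gaussianReal 0 v := by
        refine lintegral_mono fun x => ENNReal.ofReal_le_ofReal ?_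
        rcases abs_cases x with ⟨h, -⟩ | ⟨h, -⟩
        · rw [h]
          linarith [Real.exp_pos (-τ * x)]
        · rw [h, mul_neg, ← neg_mul]
          linarith [Real.exp_pos (τ * x)]
    _ = ENNReal.ofReal (∫ x, Real.exp (τ * x) + Real.exp (-τ * x) ∂gaussianReal 0 v) :=
        (ofReal_integral_eq_lintegral_ofReal ((hi τ).add (hi (-τ)))
          (Filter.Eventually.of_forall fun x =>
            add_nonneg (Real.exp_pos _).le (Real.exp_pos _).le)).symm
    _ ≤ _ := by
        refine ENNReal.ofReal_le_ofReal ?_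
        rw [integral_add (hi τ) (hi (-τ))]
        have h2 := hm (-τ)
        rw [neg_sq] at h2
        linarith [hm τ]

theorem lintegral_abs_gaussianReal_le {v : NNReal} (hv : v ≤ 1) :
    ∫⁻ x, ENNReal.ofReal |x| ∂gaussianReal 0 v ≤ 1 := by
  have hL : MemLp (fun x : ℝ => x) 2 (gaussianReal 0 v) := memLp_id_gaussianReal' 2 (by simp)
  have hvar : ∫ x, x ^ 2 ∂gaussianReal 0 v = v := by
    rw [← variance_of_integral_eq_zero aemeasurable_id' integral_id_gaussianReal]
    exact variance_fun_id_gaussianReal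
  have hint : Integrable (fun x : ℝ => (1 + x ^ 2) / 2) (gaussianReal 0 v) :=
    ((integrable_const 1).add hL.integrable_sq).div_const 2
  calc ∫⁻ x, ENNReal.ofReal |x| ∂gaussianReal 0 v
      ≤ ∫⁻ x, ENNReal.ofReal ((1 + x ^ 2) / 2) ∂gaussianReal 0 v := by
        refine lintegral_mono fun x => ENNReal.ofReal_le_ofReal ?_
        nlinarith [sq_nonneg (|x| - 1), sq_abs x]
    _ = ENNReal.ofReal (∫ x, (1 + x ^ 2) / 2 ∂gaussianReal 0 v) :=
        (ofReal_integral_eq_lintegral_ofReal hint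
          (Filter.Eventually.of_forall fun x => by positivity)).symm
    _ ≤ 1 := by
        rw [← ENNReal.ofReal_one]
        refine ENNReal.ofReal_le_ofReal ?_
        rw [integral_div, integral_add (integrable_const 1) hL.integrable_sq, hvar]
        have : (v : ℝ) ≤ 1 := by exact_mod_cast hv
        simp
        linarith

/-- The absolute value of `y` if it lies in the band `[lo, hi]`, and zero otherwise. -/
noncomputable def bandAbs (lo hi y : ℝ) : ℝ := if lo ≤ |y| ∧ |y| ≤ hi then |y| else 0

theorem bandAbs_nonneg (lo hi y : ℝ) : 0 ≤ bandAbs lo hi y := by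
  unfold bandAbs
  split_ifs <;> positivity

theorem bandAbs_le {lo hi : ℝ} (hhi : 0 ≤ hi) (y : ℝ) : bandAbs lo hi y ≤ hi := by
  unfold bandAbs
  split_ifs with h
  exacts [h.2, hhi]

theorem measurable_bandAbs (lo hi : ℝ) : Measurable (bandAbs lo hi) := by
  unfold bandAbs
  have habs : Measurable fun y : ℝ => |y| := by fun_prop
  exact Measurable.ite ((measurableSet_le measurable_const habs).inter
    (measurableSet_le habs measurable_const)) habs measurable_const

theorem gaussianPDFReal_mul_abs_le (x : ℝ) :
    gaussianPDFReal 0 1 x * (|x| * (1 + |x|)) ≤ 3 := by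
  rw [gaussianPDFReal]
  have h1 : (Real.sqrt (2 * Real.pi * (1 : NNReal)))⁻¹ ≤ 1 := by
    refine inv_le_one_of_one_le₀ (Real.one_le_sqrt.2 ?_)
    have := Real.pi_gt_three
    norm_num
    linarith
  have h2 : Real.exp (-(x - 0) ^ 2 / (2 * (1 : NNReal))) * (1 + x ^ 2 / 2) ≤ 1 := by
    have e : -(x - 0) ^ 2 / (2 * ((1 : NNReal) : ℝ)) = -(x ^ 2 / 2) := by
      simp
      ring
    rw [e, Real.exp_neg, inv_mul_le_iff₀ (Real.exp_pos _), mul_one, add_comm]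
    exact Real.add_one_le_exp _
  have h3 : |x| * (1 + |x|) ≤ 3 * (1 + x ^ 2 / 2) := by
    nlinarith [sq_nonneg (|x| - 1), sq_abs x]
  have h4 := Real.exp_pos (-(x - 0) ^ 2 / (2 * (1 : NNReal)))
  set E := Real.exp (-(x - 0) ^ 2 / (2 * (1 : NNReal)))
  have h5 : 0 ≤ (Real.sqrt (2 * Real.pi * (1 : NNReal)))⁻¹ := by positivity
  calc _ ≤ 1 * E * (3 * (1 + x ^ 2 / 2)) := by gcongr
    _ ≤ 3 := by linarith

theorem lintegral_bandAbs_gaussianReal_le {s lo hi : ℝ} (hs : 0 < s) (h : lo ≤ hi) :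
    ∫⁻ x, ENNReal.ofReal (bandAbs lo hi (s * x) * (1 + |x|)) ∂gaussianReal 0 1 ≤
      ENNReal.ofReal (6 * (hi - lo)) := by
  set S : Set ℝ := Set.Icc (lo / s) (hi / s) ∪ Set.Icc (-(hi / s)) (-(lo / s)) with hS
  have hmeas : Measurable fun x : ℝ => ENNReal.ofReal (bandAbs lo hi (s * x) * (1 + |x|)) := by
    have := (measurable_bandAbs lo hi).comp (measurable_const_mul s)
    exact (this.mul (by fun_prop)).ennreal_ofReal
  rw [gaussianReal_of_var_ne_zero _ one_ne_zero,
    lintegral_withDensity_eq_lintegral_mul _ (measurable_gaussianPDF 0 1) hmeas]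
  calc _ ≤ ∫⁻ x, S.indicator (fun _ => ENNReal.ofReal (3 * s)) x := by
        refine lintegral_mono fun x => ?_
        rw [Pi.mul_apply, gaussianPDF_def, ← ENNReal.ofReal_mul (gaussianPDFReal_nonneg _ _ _)]
        by_cases hx : lo ≤ |s * x| ∧ |s * x| ≤ hi
        · have hxS : x ∈ S := by
            rw [abs_mul, abs_of_pos hs] at hx
            rcases abs_cases x with ⟨e, -⟩ | ⟨e, -⟩ <;> rw [e] at hx
            · left
              constructor
              · rw [div_le_iff₀ hs]
                linarith
              · rw [le_div_iff₀ hs]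
                linarith
            · right
              constructor
              · rw [← neg_div, div_le_iff₀ hs]
                linarith
              · rw [← neg_div, le_div_iff₀ hs]
                linarith
          rw [Set.indicator_of_mem hxS]
          refine ENNReal.ofReal_le_ofReal ?_
          rw [bandAbs, if_pos hx, abs_mul, abs_of_pos hs]
          nlinarith [gaussianPDFReal_mul_abs_le x]
        · rw [bandAbs, if_neg hx]
          simp
    _ = ENNReal.ofReal (3 * s) * volume S := by
        rw [lintegral_indicator_const (measurableSet_Icc.union measurableSet_Icc)]
    _ ≤ ENNReal.ofReal (3 * s) * (ENNReal.ofReal (hi / s - lo / s) +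
          ENNReal.ofReal (-(lo / s) - -(hi / s))) := by
        gcongr
        refine (measure_union_le _ _).trans ?_
        rw [Real.volume_Icc, Real.volume_Icc]
    _ = ENNReal.ofReal (6 * (hi - lo)) := by
        have h1 : 0 ≤ hi / s - lo / s := by
          rw [← sub_div]
          exact div_nonneg (sub_nonneg.2 h) hs.le
        rw [← ENNReal.ofReal_add h1 (by linarith), ← ENNReal.ofReal_mul (by positivity)]
        congr 1
        field_simp
        ring

theorem bandAbs_zero (lo hi : ℝ) : bandAbs lo hi 0 = 0 := by simp [bandAbs]

theorem lintegral_abs_dotProduct_mul_bandAbs_le {n : ℕ} {w : Fin n → ℝ} (x : Fin n → ℝ)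
    (hw : vnorm w ≤ 1) {lo hi : ℝ} (h : lo ≤ hi) :
    ∫⁻ a, ENNReal.ofReal (bandAbs lo hi (a ⬝ᵥ x) * |a ⬝ᵥ w|) ∂gaussianVec n ≤
      ENNReal.ofReal (6 * (hi - lo)) := by
  by_cases hx : x = 0
  · simp [hx, bandAbs_zero]
  set s := vnorm x with hs
  have hs0 : 0 < s := (vnorm_nonneg x).lt_of_ne' (mt vnorm_eq_zero.1 hx)
  set e := s⁻¹ • x with he
  have he1 : vnorm e = 1 := vnorm_inv_smul_self hx
  have hxe : x = s • e := by rw [he, smul_smul, mul_inv_cancel₀ hs0.ne', one_smul]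
  set ρ := w ⬝ᵥ e with hρ
  set v := w - ρ • e with hv
  have hee : e ⬝ᵥ e = 1 := by rw [← vnorm_sq, he1, one_pow]
  have hve : e ⬝ᵥ v = 0 := by
    rw [hv, dotProduct_sub, dotProduct_smul, hee, dotProduct_comm e w, ← hρ]
    simp
  have hρ1 : |ρ| ≤ 1 := by
    simpa [he1] using (abs_dotProduct_le w e).trans (by rw [he1]; linarith)
  have hv1 : vnorm v ^ 2 ≤ 1 := by
    have e1 : vnorm v ^ 2 = vnorm w ^ 2 - ρ ^ 2 := by
      rw [vnorm_sq, vnorm_sq]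
      nth_rw 1 [hv]
      rw [sub_dotProduct, smul_dotProduct, hve, hv, dotProduct_sub, dotProduct_smul, ← hρ]
      simp
      ring
    nlinarith [vnorm_nonneg w, sq_nonneg ρ]
  have hwv : ∀ a : Fin n → ℝ, |a ⬝ᵥ w| ≤ |a ⬝ᵥ e| + |a ⬝ᵥ v| := fun a => by
    have e1 : a ⬝ᵥ w = ρ * (a ⬝ᵥ e) + a ⬝ᵥ v := by
      rw [hv, dotProduct_sub, dotProduct_smul ρ a e, smul_eq_mul]
      ring
    rw [e1]
    refine (abs_add_le _ _).trans ?_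
    rw [abs_mul]
    nlinarith [abs_nonneg (a ⬝ᵥ e)]
  have hme := measurable_dotProduct_const e
  have hmv := measurable_dotProduct_const v
  have hmb : Measurable fun y : ℝ => bandAbs lo hi (s * y) :=
    (measurable_bandAbs lo hi).comp (measurable_const_mul s)
  have hmbe : Measurable fun a : Fin n → ℝ => bandAbs lo hi (s * (a ⬝ᵥ e)) := hmb.comp hme
  have hmbe' : Measurable fun a : Fin n → ℝ =>
      ENNReal.ofReal (bandAbs lo hi (s * (a ⬝ᵥ e)) * |a ⬝ᵥ e|) := by fun_prop
  have hmb1 : Measurable fun y : ℝ => ENNReal.ofReal (bandAbs lo hi (s * y) * (1 + |y|)) := by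
    fun_prop
  have lawe : (gaussianVec n).map (fun a => a ⬝ᵥ e) = gaussianReal 0 1 := by
    rw [map_dotProduct_gaussianVec, he1]
    simp
  have hband : ∀ a : Fin n → ℝ, bandAbs lo hi (a ⬝ᵥ x) = bandAbs lo hi (s * (a ⬝ᵥ e)) :=
    fun a => by rw [hxe, dotProduct_smul, smul_eq_mul]
  have hind := (indepFun_dotProduct hve).comp (φ := fun y => ENNReal.ofReal (bandAbs lo hi (s * y)))
    (ψ := fun y => ENNReal.ofReal |y|) hmb.ennreal_ofReal (by fun_prop)
  have hv_int : ∫⁻ a, ENNReal.ofReal |a ⬝ᵥ v| ∂gaussianVec n ≤ 1 := by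
    have hle := lintegral_abs_gaussianReal_le (v := (vnorm v ^ 2).toNNReal)
      (Real.toNNReal_le_one.2 hv1)
    rwa [← map_dotProduct_gaussianVec, lintegral_map (by fun_prop) hmv] at hle
  calc ∫⁻ a, ENNReal.ofReal (bandAbs lo hi (a ⬝ᵥ x) * |a ⬝ᵥ w|) ∂gaussianVec n
      ≤ ∫⁻ a, (ENNReal.ofReal (bandAbs lo hi (s * (a ⬝ᵥ e)) * |a ⬝ᵥ e|) +
          ENNReal.ofReal (bandAbs lo hi (s * (a ⬝ᵥ e))) * ENNReal.ofReal |a ⬝ᵥ v|)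
          ∂gaussianVec n := by
        refine lintegral_mono fun a => ?_
        have hb := bandAbs_nonneg lo hi (s * (a ⬝ᵥ e))
        rw [← ENNReal.ofReal_mul hb, ← ENNReal.ofReal_add (by positivity) (by positivity), hband,
          ← mul_add]
        exact ENNReal.ofReal_le_ofReal (mul_le_mul_of_nonneg_left (hwv a) hb)
    _ = ∫⁻ a, ENNReal.ofReal (bandAbs lo hi (s * (a ⬝ᵥ e)) * |a ⬝ᵥ e|) ∂gaussianVec n +
          (∫⁻ a, ENNReal.ofReal (bandAbs lo hi (s * (a ⬝ᵥ e))) ∂gaussianVec n) *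
            ∫⁻ a, ENNReal.ofReal |a ⬝ᵥ v| ∂gaussianVec n := by
        rw [lintegral_add_left hmbe']
        congr 1
        exact lintegral_mul_eq_lintegral_mul_lintegral_of_indepFun
          hmbe.ennreal_ofReal (by fun_prop) hind
    _ ≤ ∫⁻ a, ENNReal.ofReal (bandAbs lo hi (s * (a ⬝ᵥ e)) * |a ⬝ᵥ e|) ∂gaussianVec n +
          (∫⁻ a, ENNReal.ofReal (bandAbs lo hi (s * (a ⬝ᵥ e))) ∂gaussianVec n) * 1 := by
        gcongr
    _ = ∫⁻ a, ENNReal.ofReal (bandAbs lo hi (s * (a ⬝ᵥ e)) * (1 + |a ⬝ᵥ e|)) ∂gaussianVec n := by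
        rw [mul_one, ← lintegral_add_left hmbe']
        refine lintegral_congr fun a => ?_
        have hb := bandAbs_nonneg lo hi (s * (a ⬝ᵥ e))
        rw [← ENNReal.ofReal_add (by positivity) hb]
        congr 1
        ring
    _ ≤ ENNReal.ofReal (6 * (hi - lo)) := by
        have hle := lintegral_bandAbs_gaussianReal_le hs0 h
        rwa [← lawe, lintegral_map hmb1 hme] at hle

theorem exp_le_one_add_add_sq_mul_exp {x : ℝ} (hx : 0 ≤ x) :
    Real.exp x ≤ 1 + x + x ^ 2 * Real.exp x := by
  have h1 : 1 - x ≤ Real.exp (-x) := by linarith [Real.add_one_le_exp (-x)]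
  have h2 : (1 - x) * Real.exp x ≤ 1 := by
    calc (1 - x) * Real.exp x ≤ Real.exp (-x) * Real.exp x := by gcongr
      _ = 1 := by rw [← Real.exp_add]; simp
  nlinarith [Real.exp_pos x]

/-- Moment generating function of `|a ⬝ᵥ w|` times the normalized band truncation of `a ⬝ᵥ x`,
for a standard Gaussian vector `a`. -/
theorem integral_exp_abs_dotProduct_mul_bandAbs_le {n : ℕ} {w : Fin n → ℝ} (x : Fin n → ℝ)
    (hw : vnorm w ≤ 1) {lo hi ε τ : ℝ} (hhi : 0 < hi) (hlo : lo ≤ hi) (hε : hi - lo ≤ 2 * ε * hi)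
    (hτ : 0 ≤ τ) :
    Integrable (fun a => Real.exp (τ / hi * (bandAbs lo hi (a ⬝ᵥ x) * |a ⬝ᵥ w|)))
        (gaussianVec n) ∧
      ∫ a, Real.exp (τ / hi * (bandAbs lo hi (a ⬝ᵥ x) * |a ⬝ᵥ w|)) ∂gaussianVec n ≤
        Real.exp (12 * ε * τ + 13 * τ ^ 2) := by
  have hε0 : 0 ≤ ε := by
    by_contra hneg
    nlinarith
  have hmw := measurable_dotProduct_const w
  have hmb := (measurable_bandAbs lo hi).comp (measurable_dotProduct_const x)
  set X : (Fin n → ℝ) → ℝ := fun a => bandAbs lo hi (a ⬝ᵥ x) * |a ⬝ᵥ w| with hX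
  have hmX : Measurable X := hmb.mul (by fun_prop)
  have hX0 : ∀ a, 0 ≤ X a := fun a => mul_nonneg (bandAbs_nonneg _ _ _) (abs_nonneg _)
  have hXle : ∀ a, τ / hi * X a ≤ τ * |a ⬝ᵥ w| := fun a => by
    have : X a ≤ hi * |a ⬝ᵥ w| :=
      mul_le_mul_of_nonneg_right (bandAbs_le hhi.le _) (abs_nonneg _)
    calc τ / hi * X a ≤ τ / hi * (hi * |a ⬝ᵥ w|) := by gcongr
      _ = τ * |a ⬝ᵥ w| := by field_simp
  have hpt : ∀ a, Real.exp (τ / hi * X a) ≤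
      1 + τ / hi * X a + τ ^ 2 * (2 * Real.exp ((τ + 1) * |a ⬝ᵥ w|)) := fun a => by
    have h0 : 0 ≤ τ / hi * X a := mul_nonneg (by positivity) (hX0 a)
    refine (exp_le_one_add_add_sq_mul_exp h0).trans ?_
    have h1 : |a ⬝ᵥ w| ^ 2 ≤ 2 * Real.exp |a ⬝ᵥ w| := by
      have := Real.quadratic_le_exp_of_nonneg (abs_nonneg (a ⬝ᵥ w))
      nlinarith [abs_nonneg (a ⬝ᵥ w)]
    have h2 : (τ / hi * X a) ^ 2 * Real.exp (τ / hi * X a) ≤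
        (τ * |a ⬝ᵥ w|) ^ 2 * Real.exp (τ * |a ⬝ᵥ w|) := by
      have := hXle a
      gcongr
    have h3 : (τ * |a ⬝ᵥ w|) ^ 2 * Real.exp (τ * |a ⬝ᵥ w|) ≤
        τ ^ 2 * (2 * Real.exp |a ⬝ᵥ w|) * Real.exp (τ * |a ⬝ᵥ w|) := by
      rw [mul_pow]
      gcongr
    have h4 : Real.exp |a ⬝ᵥ w| * Real.exp (τ * |a ⬝ᵥ w|) = Real.exp ((τ + 1) * |a ⬝ᵥ w|) := by
      rw [← Real.exp_add]
      ring_nf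
    rw [← h4]
    linarith
  have hEX : ∫⁻ a, ENNReal.ofReal (X a) ∂gaussianVec n ≤ ENNReal.ofReal (12 * ε * hi) :=
    (lintegral_abs_dotProduct_mul_bandAbs_le x hw hlo).trans
      (ENNReal.ofReal_le_ofReal (by linarith))
  have hEexp : ∫⁻ a, ENNReal.ofReal (Real.exp ((τ + 1) * |a ⬝ᵥ w|)) ∂gaussianVec n ≤
      ENNReal.ofReal (2 * Real.exp ((τ + 1) ^ 2 / 2)) := by
    have hle := lintegral_exp_mul_abs_gaussianReal_le (v := (vnorm w ^ 2).toNNReal)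
      (Real.toNNReal_le_one.2 (pow_le_one₀ (vnorm_nonneg w) hw)) (τ + 1)
    rwa [← map_dotProduct_gaussianVec, lintegral_map (by fun_prop) hmw] at hle
  have hfin : ∫⁻ a, ENNReal.ofReal (Real.exp (τ / hi * X a)) ∂gaussianVec n ≤
      ENNReal.ofReal (Real.exp (12 * ε * τ + 13 * τ ^ 2)) := by
    calc _ ≤ ∫⁻ a, (1 + ENNReal.ofReal (τ / hi) * ENNReal.ofReal (X a) +
            ENNReal.ofReal (τ ^ 2 * 2) * ENNReal.ofReal (Real.exp ((τ + 1) * |a ⬝ᵥ w|)))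
            ∂gaussianVec n := by
          refine lintegral_mono fun a => (ENNReal.ofReal_le_ofReal (hpt a)).trans ?_
          have h0 := hX0 a
          rw [ENNReal.ofReal_add (by positivity) (by positivity),
            ENNReal.ofReal_add (by positivity) (by positivity), ENNReal.ofReal_one,
            ENNReal.ofReal_mul (p := τ / hi) (by positivity), ← mul_assoc,
            ENNReal.ofReal_mul (p := τ ^ 2 * 2) (by positivity)]
      _ = 1 + ENNReal.ofReal (τ / hi) * ∫⁻ a, ENNReal.ofReal (X a) ∂gaussianVec n +
            ENNReal.ofReal (τ ^ 2 * 2) *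
              ∫⁻ a, ENNReal.ofReal (Real.exp ((τ + 1) * |a ⬝ᵥ w|)) ∂gaussianVec n := by
          rw [lintegral_add_left (by fun_prop), lintegral_add_left (by fun_prop),
            lintegral_const_mul _ (by fun_prop), lintegral_const_mul _ (by fun_prop)]
          simp
      _ ≤ 1 + ENNReal.ofReal (τ / hi) * ENNReal.ofReal (12 * ε * hi) +
            ENNReal.ofReal (τ ^ 2 * 2) * ENNReal.ofReal (2 * Real.exp ((τ + 1) ^ 2 / 2)) := by
          gcongr
      _ = ENNReal.ofReal (1 + 12 * ε * τ + 4 * τ ^ 2 * Real.exp ((τ + 1) ^ 2 / 2)) := by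
          rw [← ENNReal.ofReal_mul (by positivity), ← ENNReal.ofReal_mul (by positivity),
            ← ENNReal.ofReal_one, ← ENNReal.ofReal_add (by positivity) (by positivity),
            ← ENNReal.ofReal_add (by positivity) (by positivity)]
          congr 1
          field_simp
          ring
      _ ≤ _ := by
          refine ENNReal.ofReal_le_ofReal ?_
          have h1 : Real.exp ((τ + 1) ^ 2 / 2) ≤ 3 * Real.exp (τ ^ 2) := by
            calc Real.exp ((τ + 1) ^ 2 / 2) ≤ Real.exp (1 + τ ^ 2) := by
                  rw [Real.exp_le_exp]
                  nlinarith [sq_nonneg (τ - 1)]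
              _ = Real.exp 1 * Real.exp (τ ^ 2) := Real.exp_add _ _
              _ ≤ 3 * Real.exp (τ ^ 2) := by
                  gcongr
                  linarith [Real.exp_one_lt_d9]
          have h2 : 1 ≤ Real.exp (12 * ε * τ) := Real.one_le_exp (by positivity)
          have h3 := Real.add_one_le_exp (12 * ε * τ)
          have h4 : 1 + 12 * τ ^ 2 * Real.exp (τ ^ 2) ≤ Real.exp (13 * τ ^ 2) := by
            have e1 : Real.exp (13 * τ ^ 2) = Real.exp (12 * τ ^ 2) * Real.exp (τ ^ 2) := by
              rw [← Real.exp_add]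
              ring_nf
            have e2 := Real.add_one_le_exp (12 * τ ^ 2)
            have e3 : 1 ≤ Real.exp (τ ^ 2) := Real.one_le_exp (by positivity)
            rw [e1]
            nlinarith
          have h5 : 0 ≤ τ ^ 2 * Real.exp (τ ^ 2) := by positivity
          rw [Real.exp_add]
          calc 1 + 12 * ε * τ + 4 * τ ^ 2 * Real.exp ((τ + 1) ^ 2 / 2)
              ≤ Real.exp (12 * ε * τ) + 4 * τ ^ 2 * (3 * Real.exp (τ ^ 2)) := by
                gcongr
                linarith
            _ ≤ Real.exp (12 * ε * τ) * (1 + 12 * τ ^ 2 * Real.exp (τ ^ 2)) := by nlinarith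
            _ ≤ _ := by gcongr
  have hint : Integrable (fun a => Real.exp (τ / hi * X a)) (gaussianVec n) := by
    refine ⟨by fun_prop, ?_⟩
    rw [hasFiniteIntegral_iff_ofReal (Filter.Eventually.of_forall fun a => (Real.exp_pos _).le)]
    exact hfin.trans_lt ENNReal.ofReal_lt_top
  refine ⟨hint, ?_⟩
  rwa [← ofReal_integral_eq_lintegral_ofReal hint
    (Filter.Eventually.of_forall fun a => (Real.exp_pos _).le),
    ENNReal.ofReal_le_ofReal_iff (Real.exp_pos _).le] at hfin

/-- Chernoff bound for the band-truncated sums with `ℓ²`-bounded weights. -/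
theorem gaussianMatrices_bandAbs_sum_ge_le {n q m : ℕ} (x : Fin q → Fin n → ℝ) {w : Fin n → ℝ}
    {z : Fin q → ℝ} (hw : vnorm w ≤ 1) (hz : vnorm z ≤ 1) {lo hi ε : ℝ} (hhi : 0 < hi)
    (hlo : lo ≤ hi) (hε0 : 0 ≤ ε) (hε : hi - lo ≤ 2 * ε * hi) :
    gaussianMatrices q m n {ω | m * (26 * ε * √q * hi) ≤
        ∑ k, ∑ i, |z k| * (bandAbs lo hi (ω k i ⬝ᵥ x k) * |ω k i ⬝ᵥ w|)} ≤
      ENNReal.ofReal (Real.exp (-(ε ^ 2 * m * q))) := by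
  set lam : ℝ := ε * √q / hi with hlam
  have hlam0 : 0 ≤ lam := by positivity
  set τ : Fin q → ℝ := fun k => ε * √q * |z k| with hτ
  set f : Fin q → (Fin n → ℝ) → ℝ := fun k a =>
    Real.exp (τ k / hi * (bandAbs lo hi (a ⬝ᵥ x k) * |a ⬝ᵥ w|)) with hf
  have hfk := fun k => integral_exp_abs_dotProduct_mul_bandAbs_le (x k) hw hhi hlo hε
    (show 0 ≤ τ k by positivity)
  have hexp : ∀ ω : Fin q → Fin m → Fin n → ℝ,
      Real.exp (lam * ∑ k, ∑ i, |z k| * (bandAbs lo hi (ω k i ⬝ᵥ x k) * |ω k i ⬝ᵥ w|)) =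
        ∏ k, ∏ i, f k (ω k i) := fun ω => by
    simp_rw [hf, ← Real.exp_sum, Finset.mul_sum]
    congr 1
    refine Finset.sum_congr rfl fun k _ => Finset.sum_congr rfl fun i _ => ?_
    rw [hlam, hτ]
    ring
  have hint : Integrable (fun ω : Fin q → Fin m → Fin n → ℝ => ∏ k, ∏ i, f k (ω k i))
      (gaussianMatrices q m n) :=
    Integrable.fintype_prod (f := fun k (y : Fin m → Fin n → ℝ) => ∏ i, f k (y i)) fun k =>
      Integrable.fintype_prod (f := fun _ => f k) fun _ => (hfk k).1
  have hprod : ∫ ω, ∏ k, ∏ i, f k (ω k i) ∂gaussianMatrices q m n ≤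
      Real.exp (m * (25 * ε ^ 2 * q)) := by
    have e1 : ∫ ω, ∏ k, ∏ i, f k (ω k i) ∂gaussianMatrices q m n =
        ∏ k, ∏ _i : Fin m, ∫ a, f k a ∂gaussianVec n := by
      unfold gaussianMatrices
      rw [integral_fintype_prod_eq_prod (fun k (y : Fin m → Fin n → ℝ) => ∏ i, f k (y i))]
      refine Finset.prod_congr rfl fun k _ => ?_
      rw [integral_fintype_prod_eq_prod (fun _ => f k)]
    have hsum : ∑ k, |z k| ≤ √q := (sum_abs_le_sqrt_mul_vnorm z).trans
      (mul_le_of_le_one_right (Real.sqrt_nonneg _) hz)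
    have hsq : ∑ k, |z k| ^ 2 ≤ 1 := by
      have : ∑ k, |z k| ^ 2 = vnorm z ^ 2 := by
        rw [vnorm_sq]
        exact Finset.sum_congr rfl fun k _ => by rw [sq_abs, sq]
      rw [this]
      exact pow_le_one₀ (vnorm_nonneg z) hz
    have hq : √(q : ℝ) ^ 2 = q := Real.sq_sqrt (Nat.cast_nonneg q)
    calc _ = ∏ k, ∏ _i : Fin m, ∫ a, f k a ∂gaussianVec n := e1
      _ ≤ ∏ k, ∏ _i : Fin m, Real.exp (12 * ε * τ k + 13 * τ k ^ 2) := by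
          have hnn : ∀ k, 0 ≤ ∫ a, f k a ∂gaussianVec n := fun k =>
            integral_nonneg fun a => (Real.exp_pos _).le
          exact Finset.prod_le_prod (fun k _ => Finset.prod_nonneg fun _ _ => hnn k)
            fun k _ => Finset.prod_le_prod (fun _ _ => hnn k) fun _ _ => (hfk k).2
      _ = Real.exp (m * (12 * ε ^ 2 * √q * ∑ k, |z k| + 13 * ε ^ 2 * q * ∑ k, |z k| ^ 2)) := by
          simp_rw [← Real.exp_sum]
          congr 1
          simp only [Finset.sum_const, Finset.card_univ, Fintype.card_fin, nsmul_eq_mul, hτ]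
          rw [← Finset.mul_sum, Finset.sum_add_distrib, Finset.mul_sum, Finset.mul_sum]
          congr 2
          · exact Finset.sum_congr rfl fun k _ => by ring
          · refine Finset.sum_congr rfl fun k _ => ?_
            rw [mul_pow, mul_pow, hq]
            ring
      _ ≤ Real.exp (m * (12 * ε ^ 2 * √q * √q + 13 * ε ^ 2 * q * 1)) := by gcongr
      _ = _ := by
          rw [mul_assoc (12 * ε ^ 2), ← sq, hq]
          ring_nf
  have hch := measure_ge_le_exp_mul_mgf (μ := gaussianMatrices q m n)
    (X := fun ω => ∑ k, ∑ i, |z k| * (bandAbs lo hi (ω k i ⬝ᵥ x k) * |ω k i ⬝ᵥ w|))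
    (m * (26 * ε * √q * hi)) hlam0 (by simpa only [hexp] using hint)
  rw [← ofReal_measureReal]
  refine ENNReal.ofReal_le_ofReal (hch.trans ?_)
  rw [mgf]
  simp only [hexp]
  calc _ ≤ Real.exp (-lam * (m * (26 * ε * √q * hi))) * Real.exp (m * (25 * ε ^ 2 * q)) := by
        gcongr
    _ = _ := by
        have hq : √(q : ℝ) * √q = q := Real.mul_self_sqrt (Nat.cast_nonneg q)
        have e : -lam * (m * (26 * ε * √q * hi)) = -(26 * ε ^ 2 * m * (√q * √q)) := by
          rw [hlam]
          field_simp
        rw [← Real.exp_add, e, hq]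
        ring_nf

theorem initMat_of_nonpos {n q m : ℕ} (x : Fin q → Fin n → ℝ) {α : ℝ} (hα : α ≤ 0)
    (ω : Fin q → Fin m → Fin n → ℝ) : initMat x α ω = 0 := by
  ext j k
  simp only [initMat, Matrix.of_apply, Matrix.zero_apply]
  refine mul_eq_zero_of_right _ (Finset.sum_eq_zero fun i _ => ?_)
  split_ifs with h
  · rw [pow_eq_zero_iff two_ne_zero |>.1 (le_antisymm (h.trans hα) (sq_nonneg _))]
    simp
  · simp

theorem abs_dotProduct_initMat_sub_mulVec_le {n q m : ℕ} (x : Fin q → Fin n → ℝ) {α₀ α α₁ : ℝ}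
    (h₀ : α₀ ≤ α) (h₁ : α ≤ α₁) (ω : Fin q → Fin m → Fin n → ℝ) (v : Fin n → ℝ)
    (z : Fin q → ℝ) :
    |v ⬝ᵥ (initMat x α ω - initMat x α₁ ω).mulVec z| ≤
      (∑ k, ∑ i, |z k| * (bandAbs √α₀ √α₁ (ω k i ⬝ᵥ x k) * |ω k i ⬝ᵥ v|)) / m := by
  set d : ℝ → ℝ := fun y => y * ((if y ^ 2 ≤ α then 1 else 0) - (if y ^ 2 ≤ α₁ then 1 else 0))
    with hd
  have hdle : ∀ y, |d y| ≤ bandAbs √α₀ √α₁ y := fun y => by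
    by_cases hy : y ^ 2 ≤ α
    · simp [hd, hy, hy.trans h₁, bandAbs_nonneg]
    · by_cases hy' : y ^ 2 ≤ α₁
      · have hb : √α₀ ≤ |y| ∧ |y| ≤ √α₁ :=
          ⟨Real.sqrt_le_iff.2 ⟨abs_nonneg y, by rw [sq_abs]; linarith⟩, Real.abs_le_sqrt hy'⟩
        simp [hd, hy, hy', bandAbs, hb]
      · simp [hd, hy, hy', bandAbs_nonneg]
  have hexp : v ⬝ᵥ (initMat x α ω - initMat x α₁ ω).mulVec z =
      (∑ k, ∑ i, z k * (d (ω k i ⬝ᵥ x k) * (ω k i ⬝ᵥ v))) / m := by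
    have hM : ∀ j k, (initMat x α ω - initMat x α₁ ω) j k =
        (∑ i, ω k i j * d (ω k i ⬝ᵥ x k)) / m := fun j k => by
      simp only [initMat, Matrix.sub_apply, Matrix.of_apply]
      rw [← mul_sub, ← Finset.sum_sub_distrib, one_div_mul_eq_div]
      congr 1
      exact Finset.sum_congr rfl fun i _ => by rw [hd]; ring
    simp only [dotProduct, Matrix.mulVec, hM, Finset.mul_sum, Finset.sum_div, Finset.sum_mul]
    rw [Finset.sum_comm]
    refine Finset.sum_congr rfl fun k _ => ?_
    rw [Finset.sum_comm]
    refine Finset.sum_congr rfl fun i _ => Finset.sum_congr rfl fun j _ => ?_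
    ring
  rw [hexp, abs_div, Nat.abs_cast]
  refine div_le_div_of_nonneg_right ?_ (Nat.cast_nonneg m)
  refine (Finset.abs_sum_le_sum_abs _ _).trans (Finset.sum_le_sum fun k _ => ?_)
  refine (Finset.abs_sum_le_sum_abs _ _).trans (Finset.sum_le_sum fun i _ => ?_)
  rw [abs_mul, abs_mul]
  have := hdle (ω k i ⬝ᵥ x k)
  gcongr

/-- Uniformly over all thresholds within relative distance `ε` of `A`, the truncated initialization
matrix is close in spectral norm to the one with threshold `(1 + ε) * A`. -/
theorem gaussianMatrices_spec_initMat_sub_le {n q m : ℕ} (x : Fin q → Fin n → ℝ) {A ε : ℝ}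
    (hA : 0 < A) (hε0 : 0 < ε) (hε1 : ε < 1) :
    gaussianMatrices q m n {ω | ∃ α, (1 - ε) * A ≤ α ∧ α ≤ (1 + ε) * A ∧
        52 * ε * √q * √((1 + ε) * A) < spec (initMat x α ω - initMat x ((1 + ε) * A) ω)} ≤
      ENNReal.ofReal (Real.exp (5 * ((n : ℝ) + q) - ε ^ 2 * m * q)) := by
  obtain ⟨N₁, hN₁card, hN₁, hcover₁⟩ := exists_net n
  obtain ⟨N₂, hN₂card, hN₂, hcover₂⟩ := exists_net q
  set lo := √((1 - ε) * A) with hlo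
  set hi := √((1 + ε) * A) with hhi
  have hA0 : 0 ≤ (1 - ε) * A := mul_nonneg (by linarith) hA.le
  have hA1 : 0 < (1 + ε) * A := by positivity
  have hhi0 : 0 < hi := Real.sqrt_pos.2 hA1
  have hlohi : lo ≤ hi := Real.sqrt_le_sqrt (by nlinarith)
  have hgap : hi - lo ≤ 2 * ε * hi := by
    have h1 : lo ^ 2 = (1 - ε) * A := Real.sq_sqrt hA0
    have h2 : hi ^ 2 = (1 + ε) * A := Real.sq_sqrt hA1.le
    have h3 : hi * (hi - lo) ≤ 2 * ε * A := by nlinarith [Real.sqrt_nonneg ((1 - ε) * A)]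
    have h4 : A ≤ hi ^ 2 := by nlinarith
    refine le_of_mul_le_mul_left ?_ hhi0
    nlinarith
  set B : (Fin n → ℝ) → (Fin q → ℝ) → Set (Fin q → Fin m → Fin n → ℝ) := fun v z =>
    {ω | m * (26 * ε * √q * hi) ≤
      ∑ k, ∑ i, |z k| * (bandAbs lo hi (ω k i ⬝ᵥ x k) * |ω k i ⬝ᵥ v|)} with hB
  have hsub : {ω : Fin q → Fin m → Fin n → ℝ | ∃ α, (1 - ε) * A ≤ α ∧ α ≤ (1 + ε) * A ∧
      52 * ε * √q * hi < spec (initMat x α ω - initMat x ((1 + ε) * A) ω)} ⊆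
      ⋃ p ∈ N₁ ×ˢ N₂, B p.1 p.2 := by
    rintro ω ⟨α, h0, h1, hlt⟩
    by_contra hω
    simp only [Set.mem_iUnion, Finset.mem_product, not_exists, Prod.forall, and_imp, hB,
      Set.mem_ofPred_eq, not_le] at hω
    have hnet := spec_le_of_net (initMat x α ω - initMat x ((1 + ε) * A) ω)
      (t := 26 * ε * √q * hi) (by positivity) hN₁ hcover₁ hcover₂ fun v hv z hz =>
        (abs_dotProduct_initMat_sub_mulVec_le x h0 h1 ω v z).trans
          (div_le_of_le_mul₀ (Nat.cast_nonneg m) (by positivity)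
            ((hω v z hv hz).le.trans_eq (mul_comm _ _)))
    linarith
  have hcard : ((N₁ ×ˢ N₂).card : ℝ) ≤ Real.exp (5 * ((n : ℝ) + q)) := by
    have h64 : (64 : ℝ) ≤ Real.exp 5 := by
      have e : Real.exp 5 = Real.exp 1 ^ 5 := by
        rw [← Real.exp_nat_mul]
        norm_num
      calc (64 : ℝ) ≤ 2.7 ^ 5 := by norm_num
        _ ≤ Real.exp 1 ^ 5 := by
          gcongr
          linarith [Real.exp_one_gt_d9]
        _ = _ := e.symm
    calc ((N₁ ×ˢ N₂).card : ℝ) ≤ 64 ^ n * 64 ^ q := by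
          rw [Finset.card_product]
          exact_mod_cast Nat.mul_le_mul hN₁card hN₂card
      _ = 64 ^ (n + q) := (pow_add _ _ _).symm
      _ ≤ Real.exp 5 ^ (n + q) := by gcongr
      _ = _ := by
          rw [← Real.exp_nat_mul]
          push_cast
          ring_nf
  calc _ ≤ gaussianMatrices q m n (⋃ p ∈ N₁ ×ˢ N₂, B p.1 p.2) := measure_mono hsub
    _ ≤ ∑ p ∈ N₁ ×ˢ N₂, gaussianMatrices q m n (B p.1 p.2) := measure_biUnion_finset_le _ _
    _ ≤ ∑ _p ∈ N₁ ×ˢ N₂, ENNReal.ofReal (Real.exp (-(ε ^ 2 * m * q))) := by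
        refine Finset.sum_le_sum fun p hp => ?_
        rw [Finset.mem_product] at hp
        exact gaussianMatrices_bandAbs_sum_ge_le x (hN₁ _ hp.1) (hN₂ _ hp.2) hhi0 hlohi hε0.le hgap
    _ = ENNReal.ofReal ((N₁ ×ˢ N₂).card * Real.exp (-(ε ^ 2 * m * q))) := by
        rw [Finset.sum_const, nsmul_eq_mul, ENNReal.ofReal_mul (Nat.cast_nonneg _),
          ENNReal.ofReal_natCast]
    _ ≤ _ := by
        refine ENNReal.ofReal_le_ofReal ?_
        rw [sub_eq_add_neg, Real.exp_add]
        gcongr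

theorem vnorm_mulVec_of_transpose_mul_self_eq_one {ι ι' : Type*} [Fintype ι] [Fintype ι']
    [DecidableEq ι'] {U : Matrix ι ι' ℝ} (hU : Uᵀ * U = 1) (z : ι' → ℝ) :
    vnorm (U.mulVec z) = vnorm z := by
  have h : vnorm (U.mulVec z) ^ 2 = vnorm z ^ 2 := by
    rw [vnorm_sq, vnorm_sq, dotProduct_mulVec, ← mulVec_transpose, mulVec_mulVec, hU, one_mulVec]
  exact (pow_left_inj₀ (vnorm_nonneg _) (vnorm_nonneg _) two_ne_zero).1 h

theorem sigMin_nonneg {ι ι' : Type*} [Fintype ι] [Fintype ι'] (B : Matrix ι ι' ℝ) :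
    0 ≤ sigMin B := by
  refine Real.sInf_nonneg ?_
  rintro _ ⟨w, -, rfl⟩
  exact vnorm_nonneg _

theorem sigMin_le_spec_mul {ι : Type*} [Fintype ι] {r q : ℕ} {U : Matrix ι (Fin r) ℝ}
    (hU : Uᵀ * U = 1) (B : Matrix (Fin r) (Fin q) ℝ) : sigMin B ≤ spec (U * B) := by
  by_cases hne : {c | ∃ w, vnorm w = 1 ∧ c = vnorm (Bᵀ.mulVec w)}.Nonempty
  · obtain ⟨_, w, hw, -⟩ := hne
    have hle : sigMin B ≤ vnorm (Bᵀ.mulVec w) :=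
      csInf_le ⟨0, by rintro _ ⟨_, -, rfl⟩; exact vnorm_nonneg _⟩ ⟨w, hw, rfl⟩
    refine hle.trans ?_
    set u := Bᵀ.mulVec w with hu
    rcases (vnorm_nonneg u).eq_or_lt with h0 | h0
    · rw [← h0]
      exact spec_nonneg _
    have h1 : vnorm u ^ 2 ≤ vnorm (B.mulVec u) := by
      calc vnorm u ^ 2 = w ⬝ᵥ B.mulVec u := by
            rw [vnorm_sq, dotProduct_mulVec, ← mulVec_transpose, transpose_transpose,
              dotProduct_comm]
        _ ≤ vnorm w * vnorm (B.mulVec u) := (le_abs_self _).trans (abs_dotProduct_le _ _)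
        _ = _ := by rw [hw, one_mul]
    have h2 := vnorm_mulVec_le_spec (U * B) u
    rw [← mulVec_mulVec, vnorm_mulVec_of_transpose_mul_self_eq_one hU] at h2
    refine le_of_mul_le_mul_right ?_ h0
    nlinarith
  · rw [sigMin, Set.not_nonempty_iff_eq_empty.1 hne, Real.sInf_empty]
    exact spec_nonneg _

/-- **Lemma B.1** (closeness of the data-dependent truncation to a fixed truncation,
no sample splitting). -/
theorem lemmaB1 :
    ∃ c C : ℝ, 0 < c ∧ 0 < C ∧
    ∀ (n q r m : ℕ) (Ustar : Matrix (Fin n) (Fin r) ℝ) (Btil : Matrix (Fin r) (Fin q) ℝ)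
      (μ ε₁ σp σm κ : ℝ),
      Ustarᵀ * Ustar = 1 → Btil.rank = r →
      σp = spec (Ustar * Btil) → σm = sigMin Btil → κ = σp / σm →
      1 ≤ μ → (∀ k, vnorm (matCol Btil k) ≤ μ * σp * Real.sqrt ((r : ℝ) / q)) →
      0 < ε₁ → ε₁ < 1 →
      gaussianMatrices q m n {ω |
          ((1 - ε₁) * frob (Ustar * Btil) ^ 2 / q ≤
              (∑ k, ∑ i, (ω k i ⬝ᵥ matCol (Ustar * Btil) k) ^ 2) / ((m : ℝ) * q) ∧
            (∑ k, ∑ i, (ω k i ⬝ᵥ matCol (Ustar * Btil) k) ^ 2) / ((m : ℝ) * q) ≤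
              (1 + ε₁) * frob (Ustar * Btil) ^ 2 / q) ∧
          C * ε₁ * μ * κ * frob (Ustar * Btil) <
            spec (initMat (fun k => matCol (Ustar * Btil) k)
                (initAlpha (fun k => matCol (Ustar * Btil) k) (9 * κ ^ 2 * μ ^ 2) ω) ω -
              initMat (fun k => matCol (Ustar * Btil) k)
                (9 * κ ^ 2 * μ ^ 2 * (1 + ε₁) * frob (Ustar * Btil) ^ 2 / q) ω)} ≤
        ENNReal.ofReal (Real.exp (C * ((n : ℝ) + q) - c * ε₁ ^ 2 * m * q / (μ ^ 2 * κ ^ 2))) := by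
  refine ⟨1, 260, one_pos, by norm_num, ?_⟩
  intro n q r m U B μ ε σp σm κ hU _ hσp hσm hκ hμ _ hε0 hε1
  set F := frob (U * B) with hF
  set x : Fin q → Fin n → ℝ := fun k => matCol (U * B) k with hx
  have hF0 : 0 ≤ F := Real.sqrt_nonneg _
  have hσm0 : 0 ≤ σm := hσm ▸ sigMin_nonneg B
  have hσ : σm ≤ σp := by
    rw [hσm, hσp]
    exact sigMin_le_spec_mul hU B
  have hκ0 : 0 ≤ κ := hκ ▸ div_nonneg (hσm0.trans hσ) hσm0
  set A := 9 * κ ^ 2 * μ ^ 2 * F ^ 2 / q with hA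
  have hAnn : 0 ≤ A := by positivity
  have hAp : 9 * κ ^ 2 * μ ^ 2 * (1 + ε) * F ^ 2 / q = (1 + ε) * A := by
    rw [hA]
    ring
  rw [hAp]
  have hα : ∀ ω : Fin q → Fin m → Fin n → ℝ,
      (1 - ε) * F ^ 2 / q ≤ (∑ k, ∑ i, (ω k i ⬝ᵥ x k) ^ 2) / ((m : ℝ) * q) →
      (∑ k, ∑ i, (ω k i ⬝ᵥ x k) ^ 2) / ((m : ℝ) * q) ≤ (1 + ε) * F ^ 2 / q →
      (1 - ε) * A ≤ initAlpha x (9 * κ ^ 2 * μ ^ 2) ω ∧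
        initAlpha x (9 * κ ^ 2 * μ ^ 2) ω ≤ (1 + ε) * A := fun ω h1 h2 => by
    have hc : 0 ≤ 9 * κ ^ 2 * μ ^ 2 := by positivity
    have e1 := mul_le_mul_of_nonneg_left h1 hc
    have e2 := mul_le_mul_of_nonneg_left h2 hc
    rw [initAlpha, hA]
    exact ⟨le_of_eq_of_le (by ring) e1, e2.trans_eq (by ring)⟩
  rcases hAnn.eq_or_lt with hA0 | hApos
  · have hempty : {ω : Fin q → Fin m → Fin n → ℝ |
        ((1 - ε) * F ^ 2 / q ≤ (∑ k, ∑ i, (ω k i ⬝ᵥ x k) ^ 2) / ((m : ℝ) * q) ∧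
          (∑ k, ∑ i, (ω k i ⬝ᵥ x k) ^ 2) / ((m : ℝ) * q) ≤ (1 + ε) * F ^ 2 / q) ∧
        260 * ε * μ * κ * F < spec (initMat x (initAlpha x (9 * κ ^ 2 * μ ^ 2) ω) ω -
          initMat x ((1 + ε) * A) ω)} = ∅ := by
      rw [Set.eq_empty_iff_forall_notMem]
      rintro ω ⟨⟨h1, h2⟩, hlt⟩
      have h3 := (hα ω h1 h2).2
      rw [← hA0, mul_zero] at h3 hlt
      rw [initMat_of_nonpos x h3, initMat_of_nonpos x le_rfl, sub_zero, spec_zero] at hlt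
      have : 0 ≤ 260 * ε * μ * κ * F := by positivity
      linarith
    exact (measure_mono_null hempty.le measure_empty).trans_le zero_le
  · have hκne : κ ≠ 0 := by
      rintro h
      simp [hA, h] at hApos
    have hqne : (q : ℝ) ≠ 0 := by
      rintro h
      simp [hA, h] at hApos
    have hσmpos : 0 < σm := hσm0.lt_of_ne' (by rintro h; simp [hκ, h] at hκne)
    have hκ1 : 1 ≤ κ := by
      rw [hκ, one_le_div hσmpos]
      exact hσ
    have hsqrt : √(q : ℝ) * √((1 + ε) * A) ≤ 5 * κ * μ * F := by
      rw [← Real.sqrt_mul (Nat.cast_nonneg q)]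
      refine Real.sqrt_le_iff.2 ⟨by positivity, ?_⟩
      have e : (q : ℝ) * ((1 + ε) * A) = (1 + ε) * 9 * (κ * μ * F) ^ 2 := by
        rw [hA]
        field_simp
      rw [e]
      nlinarith [sq_nonneg (κ * μ * F)]
    refine (measure_mono ?_).trans
      ((gaussianMatrices_spec_initMat_sub_le x hApos hε0 hε1).trans (ENNReal.ofReal_le_ofReal ?_))
    · rintro ω ⟨⟨h1, h2⟩, hlt⟩
      obtain ⟨h3, h4⟩ := hα ω h1 h2
      refine ⟨_, h3, h4, lt_of_le_of_lt ?_ hlt⟩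
      calc 52 * ε * √q * √((1 + ε) * A) = 52 * ε * (√q * √((1 + ε) * A)) := by ring
        _ ≤ 52 * ε * (5 * κ * μ * F) := by gcongr
        _ = _ := by ring
    · have h1 : 1 ≤ μ ^ 2 * κ ^ 2 := one_le_mul_of_one_le_of_one_le (one_le_pow₀ hμ)
        (one_le_pow₀ hκ1)
      have h2 : 1 * ε ^ 2 * m * q / (μ ^ 2 * κ ^ 2) ≤ ε ^ 2 * m * q := by
        rw [one_mul]
        exact div_le_self (by positivity) h1
      have h3 : (0 : ℝ) ≤ (n : ℝ) + q := by positivity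
      rw [Real.exp_le_exp]
      linarith
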